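/- Let k = m+1, A a real M×k matrix, W symmetric positive definite, t ∈ ℝ^k nonzero, and γ > 0. Let Q be a real orthogonal k×k matrix whose row indexed 0 equals tᵀ/‖t‖; write A·Qᵀ = [d, K]. Put C = (AᵀWA + γI)⁻¹, H = C AᵀW − C t·(tᵀC AᵀW)/(tᵀC t), V = (KᵀWK + γI)⁻¹, U = V KᵀW, and for y ∈ ℝ^M set z = y − d/‖t‖, θ̂^CRWLS = H y + C t/(tᵀC t), α̂^RWLS = U z. Then: (i) y − A·θ̂^CRWLS = z − K·α̂^RWLS for every y ∈ ℝ^M, and (ii) tr(A·H) = tr(K·U). -/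

import Mathlib

open Matrix

lemma vecMulVec_mul_mul_vecMulVec {ι : Type*} [Fintype ι] (B : Matrix ι ι ℝ) (t : ι → ℝ) :
    vecMulVec t t * B * vecMulVec t t = (t ⬝ᵥ B *ᵥ t) • vecMulVec t t := by
  rw [vecMulVec_mul, vecMulVec_mul_vecMulVec, dotProduct_mulVec]
  ext i j
  simp [vecMulVec_apply, mul_left_comm]

section ConstrainedInverse

variable {ι κ : Type*} [Fintype ι] [DecidableEq ι] [Fintype κ] [DecidableEq κ]

/-- The matrix sending `b` to the minimizer of `θᵀ S θ / 2 - bᵀ θ` under the homogeneous linear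
constraint `tᵀ θ = 0`, for positive definite `S` and nonzero `t`. -/
noncomputable def constrainedInv (S : Matrix ι ι ℝ) (t : ι → ℝ) : Matrix ι ι ℝ :=
  S⁻¹ - (t ⬝ᵥ S⁻¹ *ᵥ t)⁻¹ • (S⁻¹ * vecMulVec t t * S⁻¹)

lemma Matrix.PosDef.dotProduct_inv_mulVec_ne_zero {S : Matrix ι ι ℝ} (hS : S.PosDef) {t : ι → ℝ}
    (ht : t ≠ 0) : t ⬝ᵥ S⁻¹ *ᵥ t ≠ 0 := by
  simpa using (hS.inv.dotProduct_mulVec_pos ht).ne'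

lemma vecMulVec_mul_constrainedInv {S : Matrix ι ι ℝ} (hS : S.PosDef) {t : ι → ℝ} (ht : t ≠ 0) :
    vecMulVec t t * constrainedInv S t = 0 := by
  rw [constrainedInv, mul_sub, mul_smul_comm, ← mul_assoc, ← mul_assoc,
    vecMulVec_mul_mul_vecMulVec, smul_mul_assoc,
    inv_smul_smul₀ (hS.dotProduct_inv_mulVec_ne_zero ht), sub_self]

lemma constrainedInv_mulVec_self {S : Matrix ι ι ℝ} (hS : S.PosDef) {t : ι → ℝ} (ht : t ≠ 0) :
    constrainedInv S t *ᵥ t = 0 := by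
  have h : (S⁻¹ * vecMulVec t t * S⁻¹) *ᵥ t = (t ⬝ᵥ S⁻¹ *ᵥ t) • (S⁻¹ *ᵥ t) := by
    rw [← mulVec_mulVec, ← mulVec_mulVec, vecMulVec_mulVec, op_smul_eq_smul, mulVec_smul]
  rw [constrainedInv, sub_mulVec, smul_mulVec, h,
    inv_smul_smul₀ (hS.dotProduct_inv_mulVec_ne_zero ht), sub_self]

lemma constrainedInv_mul {S : Matrix ι ι ℝ} (hS : S.PosDef) (t : ι → ℝ) :
    constrainedInv S t * S = 1 - (t ⬝ᵥ S⁻¹ *ᵥ t)⁻¹ • (S⁻¹ * vecMulVec t t) := by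
  have h : S⁻¹ * S = 1 := nonsing_inv_mul _ ((isUnit_iff_isUnit_det _).1 hS.isUnit)
  rw [constrainedInv, sub_mul, smul_mul_assoc, mul_assoc _ _ S, h, mul_one]

/-- If the columns of `P` are an orthonormal basis of the orthogonal complement of `t`, then
the constrained inverse of `S` is obtained by inverting `S` in the coordinates given by `P`. -/
lemma mul_inv_mul_transpose_eq_constrainedInv {S : Matrix ι ι ℝ} (hS : S.PosDef) {t : ι → ℝ}
    (ht : t ≠ 0) {P : Matrix ι κ ℝ} (hP : Pᵀ * P = 1)
    (hPt : P * Pᵀ = 1 - (t ⬝ᵥ t)⁻¹ • vecMulVec t t) :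
    P * (Pᵀ * S * P)⁻¹ * Pᵀ = constrainedInv S t := by
  have htt : t ⬝ᵥ t ≠ 0 := by simpa using ht
  have hPG : P * Pᵀ * constrainedInv S t = constrainedInv S t := by
    rw [hPt, sub_mul, smul_mul_assoc, vecMulVec_mul_constrainedInv hS ht]
    simp
  have hGP : constrainedInv S t * (P * Pᵀ) = constrainedInv S t := by
    rw [hPt, mul_sub, mul_smul_comm, mul_vecMulVec, constrainedInv_mulVec_self hS ht]
    simp
  have hEP : vecMulVec t t * P = 0 := by
    have h : vecMulVec t t * (P * Pᵀ) = 0 := by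
      have hE := vecMulVec_mul_mul_vecMulVec 1 t
      rw [mul_one, one_mulVec] at hE
      rw [hPt, mul_sub, mul_smul_comm, hE, inv_smul_smul₀ htt, mul_one, sub_self]
    calc vecMulVec t t * P = vecMulVec t t * (P * Pᵀ) * P := by
          simp only [Matrix.mul_assoc, hP, Matrix.mul_one]
      _ = 0 := by rw [h, Matrix.zero_mul]
  have hinv : (Pᵀ * S * P)⁻¹ = Pᵀ * constrainedInv S t * P := by
    refine inv_eq_left_inv ?_
    calc Pᵀ * constrainedInv S t * P * (Pᵀ * S * P)
        = Pᵀ * ((constrainedInv S t * (P * Pᵀ)) * S * P) := by simp only [Matrix.mul_assoc]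
      _ = 1 := by
        rw [hGP, constrainedInv_mul hS, Matrix.sub_mul, Matrix.smul_mul, Matrix.mul_assoc S⁻¹,
          hEP, Matrix.mul_zero, smul_zero, sub_zero, Matrix.one_mul, hP]
  calc P * (Pᵀ * S * P)⁻¹ * Pᵀ
      = (P * Pᵀ * constrainedInv S t) * (P * Pᵀ) := by rw [hinv]; simp only [Matrix.mul_assoc]
    _ = constrainedInv S t := by rw [hPG, hGP]

end ConstrainedInverse

/-- **second part of Proposition 5.** With
`θ̂^CRWLS = H y + C t/(tᵀ C t)` in the original model and `α̂^RWLS = U z` in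
the reduced model: (i) the residuals coincide, `y − Aθ̂^CRWLS = z − Kα̂^RWLS`
for every `y`; (ii) `tr(AH) = tr(KU)`. -/
theorem stmt_15 {M m : ℕ} (A : Matrix (Fin M) (Fin (m + 1)) ℝ)
    (W : Matrix (Fin M) (Fin M) ℝ) (hW : W.PosDef)
    (t : Fin (m + 1) → ℝ) (ht : t ≠ 0) (γ : ℝ) (hγ : 0 < γ)
    (Q : Matrix (Fin (m + 1)) (Fin (m + 1)) ℝ) (hQ : Qᵀ * Q = 1)
    (hQrow : ∀ j, Q 0 j = t j / Real.sqrt (t ⬝ᵥ t))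
    (d : Fin M → ℝ) (hd : ∀ j, d j = (A * Qᵀ) j 0)
    (K : Matrix (Fin M) (Fin m) ℝ) (hK : ∀ j i, K j i = (A * Qᵀ) j i.succ)
    (C : Matrix (Fin (m + 1)) (Fin (m + 1)) ℝ)
    (hC : C = (Aᵀ * W * A + γ • (1 : Matrix (Fin (m + 1)) (Fin (m + 1)) ℝ))⁻¹)
    (H : Matrix (Fin (m + 1)) (Fin M) ℝ)
    (hH : H = C * Aᵀ * W -
      (t ⬝ᵥ C *ᵥ t)⁻¹ • (C * vecMulVec t t * C * Aᵀ * W))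
    (V : Matrix (Fin m) (Fin m) ℝ)
    (hV : V = (Kᵀ * W * K + γ • (1 : Matrix (Fin m) (Fin m) ℝ))⁻¹)
    (U : Matrix (Fin m) (Fin M) ℝ) (hU : U = V * Kᵀ * W)
    (z : (Fin M → ℝ) → Fin M → ℝ)
    (hz : ∀ y, z y = y - (Real.sqrt (t ⬝ᵥ t))⁻¹ • d)
    (θCRWLS : (Fin M → ℝ) → Fin (m + 1) → ℝ)
    (hθCRWLS : ∀ y, θCRWLS y = H *ᵥ y + (t ⬝ᵥ C *ᵥ t)⁻¹ • (C *ᵥ t))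
    (αRWLS : (Fin M → ℝ) → Fin m → ℝ)
    (hαRWLS : ∀ y, αRWLS y = U *ᵥ z y) :
    (∀ y : Fin M → ℝ, y - A *ᵥ θCRWLS y = z y - K *ᵥ αRWLS y) ∧
      (A * H).trace = (K * U).trace := by
  set S := Aᵀ * W * A + γ • (1 : Matrix (Fin (m + 1)) (Fin (m + 1)) ℝ) with hSdef
  have hS : S.PosDef := by
    refine Matrix.PosDef.posSemidef_add ?_ (PosDef.one.smul hγ)
    simpa using hW.posSemidef.conjTranspose_mul_mul_same A
  have htt : 0 < t ⬝ᵥ t := by simpa using dotProduct_star_self_pos_iff.2 ht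
  have hsq : Real.sqrt (t ⬝ᵥ t) * Real.sqrt (t ⬝ᵥ t) = t ⬝ᵥ t := Real.mul_self_sqrt htt.le
  let P : Matrix (Fin (m + 1)) (Fin m) ℝ := Qᵀ.submatrix id Fin.succ
  have hKP : K = A * P := by
    ext j i
    simp [hK, P, mul_apply]
  have hP : Pᵀ * P = 1 := by
    ext i j
    have h := congrArg (fun B => B i.succ j.succ) (mul_eq_one_comm.1 hQ)
    simpa [P, mul_apply, one_apply] using h
  have hPt : P * Pᵀ = 1 - (t ⬝ᵥ t)⁻¹ • vecMulVec t t := by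
    rw [eq_sub_iff_add_eq, ← hQ]
    ext i j
    rw [mul_apply (M := Qᵀ), Fin.sum_univ_succ]
    simp only [transpose_apply, hQrow, Matrix.add_apply, Matrix.smul_apply, vecMulVec_apply, mul_apply, P,
      submatrix_apply, id, smul_eq_mul]
    rw [div_mul_div_comm, hsq, add_comm, inv_mul_eq_div]
  have hG := mul_inv_mul_transpose_eq_constrainedInv hS ht hP hPt
  have hVS : V = (Pᵀ * S * P)⁻¹ := by
    rw [hV, hKP, hSdef]
    simp only [transpose_mul, Matrix.mul_add, Matrix.add_mul, Matrix.mul_smul, Matrix.smul_mul,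
      Matrix.mul_one, hP, Matrix.mul_assoc]
  have hHG : H = constrainedInv S t * Aᵀ * W := by
    rw [hH, hC, constrainedInv]
    simp only [Matrix.sub_mul, Matrix.smul_mul]
  have hAH : K * U = A * H := by
    rw [hU, hVS, hHG, ← hG, hKP]
    simp only [transpose_mul, Matrix.mul_assoc]
  have hd' : (Real.sqrt (t ⬝ᵥ t))⁻¹ • d = A *ᵥ ((t ⬝ᵥ t)⁻¹ • t) := by
    ext j
    have h : d j = (A *ᵥ ((Real.sqrt (t ⬝ᵥ t))⁻¹ • t)) j := by
      simp only [hd, mul_apply, transpose_apply, hQrow, mulVec, dotProduct, Pi.smul_apply,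
        smul_eq_mul, div_eq_inv_mul]
    rw [Pi.smul_apply, h, ← Pi.smul_apply, ← mulVec_smul, smul_smul, ← mul_inv, hsq]
  have hHA : (H * A) *ᵥ t = t - ((t ⬝ᵥ t) * (t ⬝ᵥ C *ᵥ t)⁻¹) • (C *ᵥ t) := by
    have h : H * A = constrainedInv S t * S - γ • constrainedInv S t := by
      have hAWA : Aᵀ * W * A = S - γ • 1 := (add_sub_cancel_right _ _).symm
      rw [hHG, Matrix.mul_assoc, Matrix.mul_assoc, ← Matrix.mul_assoc Aᵀ, hAWA, Matrix.mul_sub,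
        Matrix.mul_smul, Matrix.mul_one]
    rw [h, sub_mulVec, smul_mulVec, constrainedInv_mulVec_self hS ht, constrainedInv_mul hS,
      ← hC, sub_mulVec, smul_mulVec, ← mulVec_mulVec, vecMulVec_mulVec, op_smul_eq_smul,
      mulVec_smul, one_mulVec, smul_zero, sub_zero, smul_smul, mul_comm]
  refine ⟨fun y => ?_, by rw [hAH]⟩
  have hHd : H *ᵥ (A *ᵥ ((t ⬝ᵥ t)⁻¹ • t)) =
      (t ⬝ᵥ t)⁻¹ • t - (t ⬝ᵥ C *ᵥ t)⁻¹ • (C *ᵥ t) := by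
    rw [mulVec_mulVec, mulVec_smul, hHA, smul_sub, smul_smul, inv_mul_cancel_left₀ htt.ne']
  rw [hθCRWLS, hαRWLS, hz, mulVec_mulVec, hAH, hd', mulVec_sub, ← mulVec_mulVec,
    ← mulVec_mulVec, hHd, mulVec_add, mulVec_sub]
  abel
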